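/- For each positive integer k, the following are equivalent: (1) the asymptotic density of A_k = {n ≥ 1 : gcd(n, F_n) = k} is positive; (2) A_k is nonempty; (3) k = gcd(ℓ(k), F_{ℓ(k)}). -/

import Mathlib

open scoped BigOperators

/-- `fibZ m` is the rank of appearance of `m`: the least positive `n` with `m ∣ F_n`. -/
noncomputable def fibZ (m : ℕ) : ℕ := sInf {n : ℕ | 0 < n ∧ m ∣ Nat.fib n}

/-- `fibL m = lcm(m, z(m))`. -/
noncomputable def fibL (m : ℕ) : ℕ := Nat.lcm m (fibZ m)

/-- `countIn S x` is the number of elements of `S` in `[1, x]`. -/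
noncomputable def countIn (S : Set ℕ) (x : ℝ) : ℕ :=
  (S ∩ {n : ℕ | 1 ≤ n ∧ (n : ℝ) ≤ x}).ncard

/-- `S` has asymptotic density `a`. -/
def HasDensity (S : Set ℕ) (a : ℝ) : Prop :=
  Filter.Tendsto (fun x : ℝ => (countIn S x : ℝ) / x) Filter.atTop (nhds a)

/-- `fibA k` is the set of positive integers `n` with `gcd(n, F_n) = k`. -/
def fibA (k : ℕ) : Set ℕ := {n : ℕ | 0 < n ∧ Nat.gcd n (Nat.fib n) = k}

/-! ### The rank of appearance -/

lemma exists_pos_dvd_fib {m : ℕ} (hm : 0 < m) : ∃ n, 0 < n ∧ m ∣ Nat.fib n := by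
  have : NeZero m := ⟨hm.ne'⟩
  let f : Equiv.Perm (ZMod m × ZMod m) :=
    { toFun := fun p => (p.2, p.1 + p.2)
      invFun := fun p => (p.2 - p.1, p.1)
      left_inv := fun p => by simp
      right_inv := fun p => by simp }
  have hf : ∀ n : ℕ, (f ^ n) (0, 1) = ((Nat.fib n : ZMod m), (Nat.fib (n + 1) : ZMod m)) := by
    intro n
    induction n with
    | zero => simp
    | succ n ih =>
      rw [pow_succ', Equiv.Perm.mul_apply, ih, Nat.fib_add_two, Nat.cast_add]
      rfl
  refine ⟨orderOf f, orderOf_pos f, ?_⟩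
  have h := hf (orderOf f)
  rw [pow_orderOf_eq_one] at h
  exact (ZMod.natCast_eq_zero_iff _ _).1 (congrArg Prod.fst h).symm

lemma fibZ_spec {m : ℕ} (hm : 0 < m) : 0 < fibZ m ∧ m ∣ Nat.fib (fibZ m) :=
  Nat.sInf_mem (s := {n : ℕ | 0 < n ∧ m ∣ Nat.fib n}) (exists_pos_dvd_fib hm)

lemma dvd_fib_iff {m : ℕ} (hm : 0 < m) (n : ℕ) : m ∣ Nat.fib n ↔ fibZ m ∣ n := by
  obtain ⟨hz, hd⟩ := fibZ_spec hm
  refine ⟨fun h => ?_, fun h => hd.trans (Nat.fib_dvd _ _ h)⟩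
  have hg : m ∣ Nat.fib (Nat.gcd (fibZ m) n) := by
    rw [Nat.fib_gcd]
    exact Nat.dvd_gcd hd h
  have hle : fibZ m ≤ Nat.gcd (fibZ m) n := Nat.sInf_le ⟨Nat.gcd_pos_of_pos_left _ hz, hg⟩
  have heq := le_antisymm (Nat.gcd_le_left n hz) hle
  exact heq ▸ Nat.gcd_dvd_right (fibZ m) n

lemma fibL_pos {m : ℕ} (hm : 0 < m) : 0 < fibL m := Nat.lcm_pos hm (fibZ_spec hm).1

lemma dvd_gcd_fib_iff {m : ℕ} (hm : 0 < m) (n : ℕ) :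
    m ∣ Nat.gcd n (Nat.fib n) ↔ fibL m ∣ n := by
  rw [Nat.dvd_gcd_iff, dvd_fib_iff hm, fibL, Nat.lcm_dvd_iff]

lemma fibL_dvd_fibL {a b : ℕ} (hb : 0 < b) (h : a ∣ b) : fibL a ∣ fibL b :=
  (dvd_gcd_fib_iff (Nat.pos_of_dvd_of_pos h hb) _).1
    (h.trans ((dvd_gcd_fib_iff hb _).2 dvd_rfl))

lemma mem_fibA_iff {k : ℕ} (hk : 0 < k) {n : ℕ} (hn : 0 < n) :
    n ∈ fibA k ↔ fibL k ∣ n ∧ ∀ p : Nat.Primes, ¬ fibL (p * k) ∣ n := by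
  have hpk : ∀ p : Nat.Primes, 0 < (p : ℕ) * k := fun p => Nat.mul_pos p.2.pos hk
  simp only [← dvd_gcd_fib_iff hk, ← dvd_gcd_fib_iff (hpk _)]
  constructor
  · rintro ⟨-, h⟩
    rw [h]
    refine ⟨dvd_rfl, fun p hp => ?_⟩
    have := Nat.le_of_dvd hk hp
    have := p.2.two_le
    nlinarith
  · rintro ⟨⟨c, hc⟩, h⟩
    refine ⟨hn, ?_⟩
    rcases eq_or_ne c 1 with rfl | hc1
    · simpa using hc
    · obtain ⟨p, hp, q, rfl⟩ := Nat.exists_prime_and_dvd hc1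
      exact (h ⟨p, hp⟩ ⟨q, by rw [hc]; ring⟩).elim

lemma fibA_nonempty_iff {k : ℕ} (hk : 0 < k) : (fibA k).Nonempty ↔ fibL k ∈ fibA k := by
  refine ⟨fun ⟨n, hn⟩ => ?_, fun h => ⟨_, h⟩⟩
  have h := (mem_fibA_iff hk hn.1).1 hn
  exact (mem_fibA_iff hk (fibL_pos hk)).2 ⟨dvd_rfl, fun p hp => h.2 p (hp.trans h.1)⟩

/-! ### Summability of `1 / fibL p` over the primes -/

lemma fib_prime_sq_eq_one {p : ℕ} (hp : p.Prime) (h5 : p ≠ 5) : (Nat.fib p : ZMod p) ^ 2 = 1 := by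
  have : Fact p.Prime := ⟨hp⟩
  let K := AlgebraicClosure (ZMod p)
  have h5' : (5 : ZMod p) ≠ 0 := by
    intro h
    have : (p : ℕ) ∣ 5 := (ZMod.natCast_eq_zero_iff 5 p).1 (by exact_mod_cast h)
    exact h5 ((Nat.prime_dvd_prime_iff_eq hp (by norm_num)).1 this)
  obtain ⟨α, hα⟩ : ∃ α : K, α ^ 2 = α + 1 := by
    obtain ⟨α, hα⟩ := IsAlgClosed.exists_root (Polynomial.X ^ 2 - Polynomial.X - 1 : Polynomial K)
      (by
        have : (Polynomial.X ^ 2 - Polynomial.X - 1 : Polynomial K).degree = 2 := by compute_degree!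
        rw [this]; norm_num)
    refine ⟨α, ?_⟩
    simp only [Polynomial.IsRoot, Polynomial.eval_sub, Polynomial.eval_pow, Polynomial.eval_X,
      Polynomial.eval_one] at hα
    linear_combination hα
  have binet : ∀ n : ℕ, (Nat.fib n : K) * (α - (1 - α)) = α ^ n - (1 - α) ^ n ∧
      (Nat.fib (n + 1) : K) * (α - (1 - α)) = α ^ (n + 1) - (1 - α) ^ (n + 1) := by
    intro n
    induction n with
    | zero => simp
    | succ n ih =>
      refine ⟨ih.2, ?_⟩
      rw [Nat.fib_add_two, Nat.cast_add, add_mul, ih.1, ih.2]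
      linear_combination (-(α ^ n) + (1 - α) ^ n) * hα
  have hsq : (α - (1 - α)) ^ 2 = algebraMap (ZMod p) K 5 := by
    rw [map_ofNat]
    linear_combination 4 * hα
  have hne : algebraMap (ZMod p) K 5 ≠ 0 := by simpa using h5'
  have h1 : (Nat.fib p : K) * (α - (1 - α)) = (α - (1 - α)) ^ p := by
    rw [(binet p).1, sub_pow_char α (1 - α)]
  have h2 : (Nat.fib p : K) ^ 2 * algebraMap (ZMod p) K 5 = algebraMap (ZMod p) K 5 := by
    rw [← hsq, ← mul_pow, h1, ← pow_mul, mul_comm, pow_mul, hsq, ← map_pow, ZMod.pow_card]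
  have h3 : (Nat.fib p : K) ^ 2 = 1 := mul_right_cancel₀ hne (by rw [h2, one_mul])
  apply (algebraMap (ZMod p) K).injective
  simpa using h3

lemma coprime_fibZ_of_prime {p : ℕ} (hp : p.Prime) (h5 : p ≠ 5) : Nat.Coprime p (fibZ p) := by
  have hcassini : ∀ n : ℕ, (Nat.fib n : ℤ) * Nat.fib (n + 2) - (Nat.fib (n + 1) : ℤ) ^ 2
      = (-1) ^ (n + 1) := by
    intro n
    induction n with
    | zero => simp
    | succ n ih =>
      rw [pow_succ (-1 : ℤ), ← ih, Nat.fib_add_two (n := n + 1), Nat.fib_add_two (n := n)]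
      push_cast
      ring
  have hdvd : p ∣ Nat.fib (p - 1) ∨ p ∣ Nat.fib (p + 1) := by
    obtain ⟨n, rfl⟩ : ∃ n, p = n + 1 := ⟨p - 1, by have := hp.pos; omega⟩
    rw [← hp.dvd_mul, Nat.add_sub_cancel]
    have : Fact (n + 1).Prime := ⟨hp⟩
    rw [← ZMod.natCast_eq_zero_iff]
    have h := congrArg (Int.cast : ℤ → ZMod (n + 1)) (hcassini n)
    have h1 := fib_prime_sq_eq_one hp h5
    have hs : ((-1 : ZMod (n + 1)) ^ (n + 1)) = -1 := ZMod.pow_card _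
    push_cast at h h1 ⊢
    rw [hs, h1] at h
    linear_combination h
  rw [hp.coprime_iff_not_dvd]
  intro hpz
  have hp1 := hp.one_lt
  rcases hdvd with h | h
  · have h' := hpz.trans ((dvd_fib_iff hp.pos _).1 h)
    have := Nat.le_of_dvd (by omega) h'
    omega
  · have h' := hpz.trans ((dvd_fib_iff hp.pos _).1 h)
    have := (Nat.dvd_add_right dvd_rfl).1 h'
    exact hp.one_lt.ne' (Nat.dvd_one.1 this)

lemma card_le_of_forall_fibZ_eq {n : ℕ} (hn : 0 < n) (s : Finset Nat.Primes)
    (hs : ∀ p ∈ s, fibZ p = n) : s.card ≤ n := by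
  have hdvd : ∏ p ∈ s, (p : ℕ) ∣ Nat.fib n := by
    refine Finset.prod_dvd_of_isRelPrime (fun p _ q _ hpq => ?_) (fun p hp => ?_)
    · exact Nat.coprime_iff_isRelPrime.1
        ((Nat.coprime_primes p.2 q.2).2 fun h => hpq (Subtype.ext h))
    · exact (dvd_fib_iff p.2.pos n).2 (hs p hp).dvd
  have h1 : 2 ^ s.card ≤ ∏ p ∈ s, (p : ℕ) := Finset.pow_card_le_prod _ _ _ fun p _ => p.2.two_le
  have h2 : ∀ m : ℕ, Nat.fib m ≤ 2 ^ m ∧ Nat.fib (m + 1) ≤ 2 ^ m := by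
    intro m
    induction m with
    | zero => simp
    | succ m ih =>
      rw [Nat.fib_add_two, pow_succ]
      omega
  exact (Nat.pow_le_pow_iff_right (by norm_num)).1
    (h1.trans ((Nat.le_of_dvd (Nat.fib_pos.2 hn) hdvd).trans (h2 n).1))

lemma summable_inv_fibZ_cube : Summable fun p : Nat.Primes => ((fibZ p : ℝ) ^ 3)⁻¹ := by
  have hsum : Summable fun n : ℕ => ((n : ℝ) ^ 2)⁻¹ := Real.summable_nat_pow_inv.2 (by norm_num)
  refine summable_of_sum_le (c := ∑' n : ℕ, ((n : ℝ) ^ 2)⁻¹) (fun p => by positivity) fun s => ?_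
  classical
  rw [← Finset.sum_fiberwise_of_maps_to (t := s.image fun p : Nat.Primes => fibZ p)
    (fun p hp => Finset.mem_image_of_mem _ hp)]
  refine le_trans (Finset.sum_le_sum fun n hn => ?_)
    (hsum.sum_le_tsum (s.image fun p : Nat.Primes => fibZ p) fun n _ => by positivity)
  obtain ⟨q, -, rfl⟩ := Finset.mem_image.1 hn
  set n := fibZ q with hnq
  have hpos : 0 < n := (fibZ_spec q.2.pos).1
  have hcard := card_le_of_forall_fibZ_eq hpos (s.filter fun p => fibZ p = n)
    fun p hp => (Finset.mem_filter.1 hp).2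
  rw [Finset.sum_congr rfl (g := fun _ => ((n : ℝ) ^ 3)⁻¹)
    fun p hp => by rw [(Finset.mem_filter.1 hp).2], Finset.sum_const, nsmul_eq_mul]
  have hn0 : (0 : ℝ) < n := by exact_mod_cast hpos
  calc _ ≤ (n : ℝ) * ((n : ℝ) ^ 3)⁻¹ := by gcongr
    _ = _ := by field_simp

lemma summable_inv_fibL : Summable fun p : Nat.Primes => ((fibL p : ℝ))⁻¹ := by
  have h1 : Summable fun p : Nat.Primes => (((p : ℕ) : ℝ) ^ (3 / 2 : ℝ))⁻¹ :=
    (Real.summable_nat_rpow_inv.2 (by norm_num : (1 : ℝ) < 3 / 2)).comp_injective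
      Nat.Primes.coe_nat_injective
  refine Summable.of_norm_bounded_eventually (h1.add summable_inv_fibZ_cube) ?_
  have hfin : {p : Nat.Primes | (p : ℕ) = 5}.Finite :=
    Set.Subsingleton.finite fun p hp q hq => Subtype.ext (hp.trans hq.symm)
  refine hfin.subset fun p hp => ?_
  by_contra h5
  refine hp ?_
  have hz : (0 : ℝ) < fibZ p := by exact_mod_cast (fibZ_spec p.2.pos).1
  have hp0 : (0 : ℝ) < (p : ℕ) := by exact_mod_cast p.2.pos
  change ‖((fibL p : ℝ))⁻¹‖ ≤ (((p : ℕ) : ℝ) ^ (3 / 2 : ℝ))⁻¹ + ((fibZ p : ℝ) ^ 3)⁻¹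
  rw [fibL, (coprime_fibZ_of_prime p.2 h5).lcm_eq_mul, Nat.cast_mul, norm_inv,
    Real.norm_of_nonneg (by positivity)]
  rcases le_total ((p : ℕ) : ℝ) ((fibZ p : ℝ) ^ 2) with h | h
  · refine le_trans ?_ (le_add_of_nonneg_right (by positivity))
    gcongr
    rw [show (3 / 2 : ℝ) = 1 + 1 / 2 by norm_num, Real.rpow_add hp0, Real.rpow_one,
      ← Real.sqrt_eq_rpow]
    gcongr
    exact (Real.sqrt_le_left hz.le).2 h
  · refine le_trans ?_ (le_add_of_nonneg_left (by positivity))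
    gcongr
    nlinarith

/-! ### Counting and density -/

lemma finite_inter_Icc (S : Set ℕ) (x : ℝ) : (S ∩ {n : ℕ | 1 ≤ n ∧ (n : ℝ) ≤ x}).Finite :=
  (Set.finite_Iic ⌊x⌋₊).subset fun _ hn => Nat.le_floor hn.2.2

lemma countIn_mono {S T : Set ℕ} (h : S ⊆ T) (x : ℝ) : countIn S x ≤ countIn T x :=
  Set.ncard_le_ncard (Set.inter_subset_inter_left _ h) (finite_inter_Icc T x)

lemma countIn_union_le (S T : Set ℕ) (x : ℝ) :
    countIn (S ∪ T) x ≤ countIn S x + countIn T x := by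
  rw [countIn, Set.union_inter_distrib_right]
  exact Set.ncard_union_le _ _

lemma countIn_diff {S T : Set ℕ} (h : T ⊆ S) (x : ℝ) :
    (countIn (S \ T) x : ℝ) = countIn S x - countIn T x := by
  rw [eq_sub_iff_add_eq, ← Nat.cast_add, countIn, countIn, countIn,
    ← Set.ncard_union_eq _ (finite_inter_Icc _ _) (finite_inter_Icc _ _),
    ← Set.union_inter_distrib_right, Set.sdiff_union_of_subset h]
  exact Set.disjoint_sdiff_left.mono Set.inter_subset_left Set.inter_subset_left

lemma countIn_image_mul (S : Set ℕ) {l : ℕ} (hl : 0 < l) (x : ℝ) :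
    countIn ((fun m => l * m) '' S) x = countIn S (x / l) := by
  have hl' : (0 : ℝ) < l := by exact_mod_cast hl
  rw [countIn, countIn, ← Set.ncard_image_of_injective (S ∩ _) (mul_right_injective₀ hl.ne')]
  congr 1
  ext n
  constructor
  · rintro ⟨⟨m, hm, rfl⟩, h1, h2⟩
    refine ⟨m, ⟨hm, Nat.pos_of_mul_pos_left h1, ?_⟩, rfl⟩
    rw [le_div_iff₀ hl']
    push_cast at h2
    linarith
  · rintro ⟨m, ⟨hm, h1, h2⟩, rfl⟩
    refine ⟨⟨m, hm, rfl⟩, Nat.mul_pos hl h1, ?_⟩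
    rw [le_div_iff₀ hl'] at h2
    push_cast
    linarith

lemma countIn_univ_le {x : ℝ} (hx : 0 ≤ x) : (countIn Set.univ x : ℝ) ≤ x := by
  refine le_trans ?_ (Nat.floor_le hx)
  have : countIn Set.univ x ≤ (Set.Icc 1 ⌊x⌋₊).ncard :=
    Set.ncard_le_ncard (fun n hn => ⟨hn.2.1, Nat.le_floor hn.2.2⟩) (Set.finite_Icc _ _)
  simpa [← Nat.card_coe_set_eq] using this

lemma hasDensity_univ : HasDensity Set.univ 1 := by
  refine (tendsto_nat_floor_div_atTop (R := ℝ)).congr' ?_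
  filter_upwards [Filter.eventually_ge_atTop 0] with x hx
  have : Set.univ ∩ {n : ℕ | 1 ≤ n ∧ (n : ℝ) ≤ x} = Set.Icc 1 ⌊x⌋₊ := by
    ext n
    simp [Nat.le_floor_iff hx]
  rw [countIn, this]
  simp [← Nat.card_coe_set_eq]

lemma HasDensity.diff {S T : Set ℕ} {a b : ℝ} (hS : HasDensity S a) (hT : HasDensity T b)
    (h : T ⊆ S) : HasDensity (S \ T) (a - b) :=
  (Filter.Tendsto.sub hS hT).congr fun x => by rw [countIn_diff h, sub_div]

lemma HasDensity.image_mul {S : Set ℕ} {a : ℝ} (hS : HasDensity S a) {l : ℕ} (hl : 0 < l) :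
    HasDensity ((fun m => l * m) '' S) (a / l) := by
  have hl' : (0 : ℝ) < l := by exact_mod_cast hl
  have h : Filter.Tendsto (fun x : ℝ => x / l) Filter.atTop Filter.atTop :=
    Filter.tendsto_id.atTop_div_const hl'
  refine ((Filter.Tendsto.comp hS h).div_const (l : ℝ)).congr fun x => ?_
  simp only [Function.comp_apply]
  rw [countIn_image_mul S hl]
  field_simp

lemma HasDensity.le {S T : Set ℕ} {a b : ℝ} (hS : HasDensity S a) (hT : HasDensity T b)
    (h : S ⊆ T) : a ≤ b := by
  refine le_of_tendsto_of_tendsto hS hT ?_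
  filter_upwards [Filter.eventually_ge_atTop 0] with x hx
  exact div_le_div_of_nonneg_right (by exact_mod_cast countIn_mono h x) hx

/-! ### Sets of non-multiples -/

/-- The density of the integers avoiding finitely many divisors exists, and is at least the product
predicted by independence (Heilbronn–Rohrbach). -/
lemma exists_hasDensity_finset {ι : Type*} (I : Finset ι) (l : ι → ℕ) (hl : ∀ i, 0 < l i) :
    ∃ d : ℝ, HasDensity {m | ∀ i ∈ I, ¬ l i ∣ m} d ∧ ∏ i ∈ I, (1 - (l i : ℝ)⁻¹) ≤ d := by
  classical
  induction I using Finset.induction_on generalizing l with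
  | empty => exact ⟨1, by simpa using hasDensity_univ, by simp⟩
  | insert a I ha ih =>
    obtain ⟨d, hd, hle⟩ := ih l hl
    obtain ⟨d', hd', -⟩ := ih (fun i => l i / Nat.gcd (l i) (l a))
      fun i => Nat.div_pos (Nat.gcd_le_left _ (hl i)) (Nat.gcd_pos_of_pos_left _ (hl i))
    have hiff : ∀ i m, l i / Nat.gcd (l i) (l a) ∣ m ↔ l i ∣ l a * m := by
      intro i m
      have hg : 0 < Nat.gcd (l i) (l a) := Nat.gcd_pos_of_pos_left _ (hl i)
      constructor
      · intro h
        obtain ⟨c, hc⟩ := Nat.gcd_dvd_right (l i) (l a)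
        have := (Nat.mul_dvd_mul_left (Nat.gcd (l i) (l a)) h).mul_right c
        rw [Nat.mul_div_cancel' (Nat.gcd_dvd_left _ _)] at this
        have h' : l a * m = Nat.gcd (l i) (l a) * m * c := by
          conv_lhs => rw [hc]
          ring
        rwa [h']
      · intro h
        refine (Nat.coprime_div_gcd_div_gcd hg).dvd_of_dvd_mul_left ?_
        rw [← Nat.mul_dvd_mul_iff_left hg, ← mul_assoc, Nat.mul_div_cancel' (Nat.gcd_dvd_left _ _),
          Nat.mul_div_cancel' (Nat.gcd_dvd_right _ _)]
        exact h
    have hdd : d' ≤ d := hd'.le hd fun m hm i hi h => hm i hi ((hiff i m).2 (h.mul_left _))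
    have hset : {m | ∀ i ∈ insert a I, ¬ l i ∣ m} = {m | ∀ i ∈ I, ¬ l i ∣ m} \
        ((fun m => l a * m) '' {m | ∀ i ∈ I, ¬ l i / Nat.gcd (l i) (l a) ∣ m}) := by
      ext m
      simp only [hiff, Finset.forall_mem_insert, Set.mem_ofPred_eq, Set.mem_sdiff, Set.mem_image,
        not_exists, not_and]
      constructor
      · rintro ⟨h1, h2⟩
        exact ⟨h2, fun j _ hj => h1 ⟨j, hj.symm⟩⟩
      · rintro ⟨h1, h2⟩
        refine ⟨?_, h1⟩
        rintro ⟨j, rfl⟩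
        exact h2 j h1 rfl
    refine ⟨d - d' / l a, ?_, ?_⟩
    · rw [hset]
      refine hd.diff (hd'.image_mul (hl a)) ?_
      rintro _ ⟨j, hj, rfl⟩ i hi h
      exact hj i hi ((hiff i j).2 h)
    · have hla : (1 : ℝ) ≤ l a := by exact_mod_cast hl a
      rw [Finset.prod_insert ha]
      calc (1 - (l a : ℝ)⁻¹) * ∏ i ∈ I, (1 - (l i : ℝ)⁻¹) ≤ (1 - (l a : ℝ)⁻¹) * d :=
            mul_le_mul_of_nonneg_left hle (sub_nonneg.2 (inv_le_one_of_one_le₀ hla))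
        _ = d - d / l a := by ring
        _ ≤ d - d' / l a := by gcongr

lemma countIn_multiples_le {l : ℕ} (hl : 0 < l) {x : ℝ} (hx : 0 ≤ x) :
    (countIn {m | l ∣ m} x : ℝ) ≤ x * (l : ℝ)⁻¹ := by
  have : {m | l ∣ m} = (fun m => l * m) '' Set.univ := by
    ext m
    simp [dvd_iff_exists_eq_mul_right, eq_comm]
  rw [this, countIn_image_mul _ hl, ← div_eq_mul_inv]
  exact countIn_univ_le (by positivity)

lemma countIn_exists_multiple_le {ι : Type*} (J : Finset ι) {l : ι → ℕ} (hl : ∀ i, 0 < l i)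
    {x : ℝ} (hx : 0 ≤ x) :
    (countIn {m | ∃ i ∈ J, l i ∣ m} x : ℝ) ≤ x * ∑ i ∈ J, (l i : ℝ)⁻¹ := by
  classical
  induction J using Finset.induction_on with
  | empty => simp [countIn]
  | insert a J ha ih =>
    have : {m | ∃ i ∈ insert a J, l i ∣ m} = {m | l a ∣ m} ∪ {m | ∃ i ∈ J, l i ∣ m} := by
      ext m
      simp
    rw [this, Finset.sum_insert ha, mul_add]
    have h : (countIn ({m | l a ∣ m} ∪ {m | ∃ i ∈ J, l i ∣ m}) x : ℝ) ≤
        countIn {m | l a ∣ m} x + countIn {m | ∃ i ∈ J, l i ∣ m} x := by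
      exact_mod_cast countIn_union_le _ _ x
    linarith [countIn_multiples_le (hl a) hx]

lemma countIn_tail_le {ι : Type*} (I : Finset ι) {l : ι → ℕ} (hl : ∀ i, 0 < l i)
    (hs : Summable fun i => (l i : ℝ)⁻¹) {x : ℝ} (hx : 0 ≤ x) :
    (countIn {m | ∃ i ∉ I, l i ∣ m} x : ℝ) ≤ x * ∑' i : {i // i ∉ I}, (l i : ℝ)⁻¹ := by
  classical
  have hfin := finite_inter_Icc {m | ∃ i ∉ I, l i ∣ m} x
  have hex : ∀ m : ↥({m | ∃ i ∉ I, l i ∣ m} ∩ {n : ℕ | 1 ≤ n ∧ (n : ℝ) ≤ x}),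
      ∃ i : {i // i ∉ I}, l i ∣ m := fun m => by
    obtain ⟨i, hi, h⟩ := m.2.1
    exact ⟨⟨i, hi⟩, h⟩
  choose f hf using hex
  have := hfin.fintype
  have h1 : countIn {m | ∃ i ∉ I, l i ∣ m} x ≤
      countIn {m | ∃ i ∈ Finset.univ.image f, l (i : ι) ∣ m} x :=
    Set.ncard_le_ncard (fun m hm => ⟨⟨f ⟨m, hm⟩, by simp, hf ⟨m, hm⟩⟩, hm.2⟩)
      (finite_inter_Icc _ x)
  calc (countIn {m | ∃ i ∉ I, l i ∣ m} x : ℝ)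
      ≤ countIn {m | ∃ i ∈ Finset.univ.image f, l (i : ι) ∣ m} x := by exact_mod_cast h1
    _ ≤ x * ∑ i ∈ Finset.univ.image f, (l (i : ι) : ℝ)⁻¹ :=
      countIn_exists_multiple_le (Finset.univ.image f) (l := fun i : {i // i ∉ I} => l i)
        (fun i => hl i) hx
    _ ≤ _ := by
      gcongr
      exact (hs.comp_injective Subtype.val_injective).sum_le_tsum _ fun i _ => by positivity

/-- If `∑ 1 / l i` converges and every `l i` exceeds `1`, then the integers divisible by no `l i`
have a positive density. -/
lemma exists_hasDensity_of_summable {ι : Type*} {l : ι → ℕ} (hl : ∀ i, 2 ≤ l i)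
    (hs : Summable fun i => (l i : ℝ)⁻¹) :
    ∃ d : ℝ, 0 < d ∧ HasDensity {m | ∀ i, ¬ l i ∣ m} d := by
  have hl0 : ∀ i, 0 < l i := fun i => by have := hl i; omega
  choose d hd hprod using fun I : Finset ι => exists_hasDensity_finset I l hl0
  have hlow : ∀ I, Real.exp (-(2 * ∑' i, (l i : ℝ)⁻¹)) ≤ d I := by
    intro I
    refine le_trans ?_ (hprod I)
    have hfac : ∀ i, Real.exp (-(2 * (l i : ℝ)⁻¹)) ≤ 1 - (l i : ℝ)⁻¹ := by
      intro i
      have h2 : (2 : ℝ) ≤ l i := by exact_mod_cast hl i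
      have hy : (l i : ℝ)⁻¹ ≤ 2⁻¹ := inv_anti₀ (by norm_num) h2
      have hy0 : 0 ≤ (l i : ℝ)⁻¹ := by positivity
      rw [Real.exp_neg]
      refine inv_le_of_inv_le₀ (by linarith) (le_trans ?_ (Real.add_one_le_exp _))
      rw [inv_le_iff_one_le_mul₀ (by linarith)]
      nlinarith
    calc _ ≤ Real.exp (∑ i ∈ I, -(2 * (l i : ℝ)⁻¹)) := by
          rw [Finset.sum_neg_distrib, ← Finset.mul_sum]
          gcongr
          exact hs.sum_le_tsum I fun i _ => by positivity
      _ = ∏ i ∈ I, Real.exp (-(2 * (l i : ℝ)⁻¹)) := Real.exp_sum _ _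
      _ ≤ _ := Finset.prod_le_prod (fun i _ => (Real.exp_pos _).le) fun i _ => hfac i
  have hanti : Antitone d := fun I J hIJ =>
    (hd J).le (hd I) fun m hm i hi => hm i (hIJ hi)
  have hbdd : BddBelow (Set.range d) := ⟨_, Set.forall_mem_range.2 hlow⟩
  have hlim : Filter.Tendsto d Filter.atTop (nhds (⨅ I, d I)) := tendsto_atTop_ciInf hanti hbdd
  refine ⟨⨅ I, d I, (Real.exp_pos _).trans_le (le_ciInf hlow), ?_⟩
  rw [HasDensity, Metric.tendsto_nhds]
  intro ε hε
  have htail := tendsto_tsum_compl_atTop_zero fun i => (l i : ℝ)⁻¹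
  obtain ⟨I, hI1, hI2⟩ := ((hlim.eventually_lt_const (lt_add_of_pos_right _ (half_pos hε))).and
    (htail.eventually_lt_const (half_pos hε))).exists
  have hI3 : ⨅ I, d I ≤ d I := ciInf_le hbdd I
  have hev := (Metric.tendsto_nhds.1 (hd I)) (ε / 2) (half_pos hε)
  filter_upwards [hev, Filter.eventually_gt_atTop 0] with x hx hx0
  rw [Real.dist_eq, abs_lt] at hx ⊢
  have hup : (countIn {m | ∀ i, ¬ l i ∣ m} x : ℝ) / x
      ≤ countIn {m | ∀ i ∈ I, ¬ l i ∣ m} x / x := by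
    gcongr
    have hsub : {m | ∀ i, ¬ l i ∣ m} ⊆ {m | ∀ i ∈ I, ¬ l i ∣ m} := fun m hm i _ => hm i
    exact countIn_mono hsub x
  have hdown : (countIn {m | ∀ i ∈ I, ¬ l i ∣ m} x : ℝ) / x ≤
      countIn {m | ∀ i, ¬ l i ∣ m} x / x + ∑' i : {i // i ∉ I}, (l i : ℝ)⁻¹ := by
    rw [div_add' _ _ _ hx0.ne']
    gcongr
    have hsub : {m | ∀ i ∈ I, ¬ l i ∣ m} ⊆ {m | ∀ i, ¬ l i ∣ m} ∪ {m | ∃ i ∉ I, l i ∣ m} := by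
      intro m hm
      by_cases h : ∀ i, ¬ l i ∣ m
      · exact Or.inl h
      · push Not at h
        obtain ⟨i, hi⟩ := h
        exact Or.inr ⟨i, fun hiI => hm i hiI hi, hi⟩
    have h1 : (countIn {m | ∀ i ∈ I, ¬ l i ∣ m} x : ℝ) ≤
        countIn {m | ∀ i, ¬ l i ∣ m} x + countIn {m | ∃ i ∉ I, l i ∣ m} x := by
      exact_mod_cast (countIn_mono hsub x).trans (countIn_union_le _ _ x)
    linarith [countIn_tail_le I hl0 hs hx0.le]
  constructor <;> linarith [hx.1, hx.2]

lemma exists_hasDensity_fibA {k : ℕ} (hk : 0 < k) (h : (fibA k).Nonempty) :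
    ∃ a : ℝ, 0 < a ∧ HasDensity (fibA k) a := by
  have hL := fibL_pos hk
  have hpk : ∀ p : Nat.Primes, 0 < (p : ℕ) * k := fun p => Nat.mul_pos p.2.pos hk
  choose l hl using fun p : Nat.Primes => fibL_dvd_fibL (hpk p) (Nat.dvd_mul_left k p)
  have hmem := (mem_fibA_iff hk hL).1 ((fibA_nonempty_iff hk).1 h)
  have hl2 : ∀ p, 2 ≤ l p := by
    intro p
    have h0 : l p ≠ 0 := fun h0 => (fibL_pos (hpk p)).ne' (by rw [hl, h0, mul_zero])
    have h1 : l p ≠ 1 := fun h1 => hmem.2 p (by rw [hl, h1, mul_one])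
    omega
  have hsum : Summable fun p => (l p : ℝ)⁻¹ := by
    refine Summable.of_nonneg_of_le (fun p => by positivity) (fun p => ?_)
      (summable_inv_fibL.mul_left (fibL k : ℝ))
    have h1 : fibL p ≤ fibL k * l p := by
      rw [← hl]
      exact Nat.le_of_dvd (fibL_pos (hpk p)) (fibL_dvd_fibL (hpk p) (Nat.dvd_mul_right _ _))
    have h1' : (fibL p : ℝ) ≤ fibL k * l p := by exact_mod_cast h1
    have h2 : (0 : ℝ) < fibL p := by exact_mod_cast fibL_pos p.2.pos
    have h3 : (0 : ℝ) < l p := by exact_mod_cast (by have := hl2 p; omega : 0 < l p)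
    rw [← div_eq_mul_inv, le_div_iff₀ h2, inv_mul_le_iff₀ h3, mul_comm]
    exact h1'
  obtain ⟨d, hd0, hd⟩ := exists_hasDensity_of_summable hl2 hsum
  refine ⟨d / fibL k, div_pos hd0 (by exact_mod_cast hL), ?_⟩
  convert hd.image_mul hL using 1
  ext n
  rcases Nat.eq_zero_or_pos n with rfl | hn
  · refine iff_of_false (fun h => h.1.false) ?_
    rintro ⟨m, hm, h0⟩
    obtain rfl : m = 0 := (Nat.mul_eq_zero.1 h0).resolve_left hL.ne'
    exact hm ⟨2, Nat.prime_two⟩ (dvd_zero _)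
  · rw [mem_fibA_iff hk hn]
    constructor
    · rintro ⟨⟨m, rfl⟩, h⟩
      exact ⟨m, fun p hp => h p (by rw [hl]; exact Nat.mul_dvd_mul_left _ hp), rfl⟩
    · rintro ⟨m, hm, rfl⟩
      refine ⟨Nat.dvd_mul_right _ _, fun p hp => hm p ?_⟩
      rw [hl] at hp
      exact Nat.dvd_of_mul_dvd_mul_left hL hp

theorem fibA_density_pos_iff (k : ℕ) (hk : 0 < k) :
    ((∃ a : ℝ, 0 < a ∧ HasDensity (fibA k) a) ↔ (fibA k).Nonempty) ∧
      ((fibA k).Nonempty ↔ k = Nat.gcd (fibL k) (Nat.fib (fibL k))) := by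
  refine ⟨⟨fun ⟨a, ha, hd⟩ => ?_, exists_hasDensity_fibA hk⟩, ?_⟩
  · by_contra hne
    rw [Set.not_nonempty_iff_eq_empty] at hne
    rw [hne] at hd
    have h0 : HasDensity ∅ 0 := by simp [HasDensity, countIn]
    exact ha.ne' (tendsto_nhds_unique hd h0)
  · rw [fibA_nonempty_iff hk]
    exact ⟨fun h => h.2.symm, fun h => ⟨fibL_pos hk, h.symm⟩⟩
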